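/- Decentralized SplitSkip convergence: let f: ℝ^{d'} → ℝ be L-smooth and μ-strongly convex, ψ proper closed convex with ∂ψ*(y) ⊆ range(L) for all y, and L ∈ ℝ^{m×d'}. If p ∈ (0,1], γ ≤ 1/L, γτ ≤ p/‖L L^T‖, and y_0 = 0, then the iterates of SplitSkip satisfy E[‖x_T - x⋆‖²] ≤ (1 - ζ)^T Φ_0, where ζ = min{γμ, pγτ·λ_min^+(L L^T)} and Φ_0 = ‖x_0 - x⋆‖² + (γ/(pτ))‖y_0 - y⋆‖². -/

import Mathlib

open RealInnerProductSpace Matrix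
noncomputable section
abbrev Euc (d : ℕ) := EuclideanSpace ℝ (Fin d)

/-- `ψ` is proper, closed (lower semicontinuous) and convex, with values in `ℝ ∪ {+∞}`. -/
def ProperClosedConvex {d : ℕ} (ψ : Euc d → EReal) : Prop :=
  (∃ x, ψ x ≠ ⊤) ∧ (∀ x, ψ x ≠ ⊥) ∧ LowerSemicontinuous ψ ∧
    ∀ x y : Euc d, ∀ a b : ℝ, 0 ≤ a → 0 ≤ b → a + b = 1 →
      ψ (a • x + b • y) ≤ (a : EReal) * ψ x + (b : EReal) * ψ y

/-- `q = prox_{αφ}(x)`. -/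
def IsProxPt {d : ℕ} (φ : Euc d → EReal) (α : ℝ) (x q : Euc d) : Prop :=
  ∀ y : Euc d, (((1:ℝ)/2 * ‖q - x‖ ^ 2 : ℝ) : EReal) + (α : EReal) * φ q ≤
    (((1:ℝ)/2 * ‖y - x‖ ^ 2 : ℝ) : EReal) + (α : EReal) * φ y

/-- The Fenchel conjugate `ψ*(y) = sup_x (⟨x,y⟩ - ψ(x))`. -/
def fenchelConj {d : ℕ} (ψ : Euc d → EReal) (y : Euc d) : EReal :=
  ⨆ x : Euc d, ((⟪x, y⟫ : ℝ) : EReal) - ψ x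

/-- `g` is a subgradient of the extended-real-valued convex function `φ` at `y`. -/
def ERealSubgrad {d : ℕ} (φ : Euc d → EReal) (y g : Euc d) : Prop :=
  ∀ z : Euc d, φ y + ((⟪g, z - y⟫ : ℝ) : EReal) ≤ φ z

/-- The smallest positive eigenvalue of the endomorphism induced by `L Lᵀ`. -/
def lamMinPos {m d : ℕ} (L : Matrix (Fin m) (Fin d) ℝ) : ℝ :=
  sInf {r : ℝ | 0 < r ∧ Module.End.HasEigenvalue
    (Matrix.toEuclideanLin (L * Lᵀ) : Module.End ℝ (Euc m)) r}

/-- One step of SplitSkip on the primal-dual state `(x, y)`. -/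
def splitSkipStep {m d' : ℕ} (f' : Euc d' → Euc d') (Lm : Matrix (Fin m) (Fin d') ℝ)
    (proxStar : Euc m → Euc m) (γ τ p : ℝ) (θ : Bool) (s : Euc d' × Euc m) :
    Euc d' × Euc m :=
  let xhat := s.1 - γ • (f' s.1 + Matrix.toEuclideanLin Lmᵀ s.2)
  if θ then
    let yn := proxStar (s.2 + τ • Matrix.toEuclideanLin Lm xhat)
    (xhat - (γ / p) • Matrix.toEuclideanLin Lmᵀ (yn - s.2), yn)
  else (xhat, s.2)

/-- The SplitSkip trajectory driven by the coin flips `θ`, started at `(x₀, 0)`. -/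
def splitSkipTraj {m d' : ℕ} (f' : Euc d' → Euc d') (Lm : Matrix (Fin m) (Fin d') ℝ)
    (proxStar : Euc m → Euc m) (γ τ p : ℝ) (x0 : Euc d') (θ : ℕ → Bool) :
    ℕ → Euc d' × Euc m
  | 0 => (x0, 0)
  | t + 1 => splitSkipStep f' Lm proxStar γ τ p (θ t)
      (splitSkipTraj f' Lm proxStar γ τ p x0 θ t)

section Gradient

variable {E : Type*} [NormedAddCommGroup E] [InnerProductSpace ℝ E] [CompleteSpace E]
  {f : E → ℝ} {f' : E → E}

lemma hasDerivAt_comp_add_smul (hgrad : ∀ x, HasGradientAt f (f' x) x) (x v : E) (t : ℝ) :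
    HasDerivAt (fun s : ℝ => f (x + s • v)) ⟪f' (x + t • v), v⟫ t := by
  have hline : HasDerivAt (fun s : ℝ => x + s • v) v t := by
    simpa using ((hasDerivAt_id t).smul_const v).const_add x
  simpa [Function.comp_def] using (hgrad (x + t • v)).hasFDerivAt.comp_hasDerivAt t hline

/-- The quadratic lower bound of a strongly convex function. -/
lemma add_inner_add_sq_le_of_stronglyConvex {μ : ℝ} (hgrad : ∀ x, HasGradientAt f (f' x) x)
    (hsc : ConvexOn ℝ Set.univ fun x => f x - μ / 2 * ‖x‖ ^ 2) (x y : E) :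
    f x + ⟪f' x, y - x⟫ + μ / 2 * ‖y - x‖ ^ 2 ≤ f y := by
  have hconv : ConvexOn ℝ Set.univ
      (fun t : ℝ => f (x + t • (y - x)) - μ / 2 * ‖x + t • (y - x)‖ ^ 2) := by
    have := hsc.comp_affineMap (AffineMap.lineMap x y)
    simpa [Function.comp_def, AffineMap.lineMap_apply, add_comm] using this
  have hline : HasDerivAt (fun s : ℝ => x + s • (y - x)) (y - x) 0 := by
    simpa using ((hasDerivAt_id (0 : ℝ)).smul_const (y - x)).const_add x
  have hderiv := (hasDerivAt_comp_add_smul hgrad x (y - x) 0).sub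
    (hline.norm_sq.const_mul (μ / 2))
  have h := hconv.le_slope_of_hasDerivAt (Set.mem_univ 0) (Set.mem_univ 1) one_pos hderiv
  simp only [slope_def_field, zero_smul, one_smul, add_zero, add_sub_cancel, sub_zero,
    div_one] at h
  have e : ‖y - x‖ ^ 2 = ‖y‖ ^ 2 - 2 * ⟪x, y⟫ + ‖x‖ ^ 2 := by
    rw [norm_sub_sq_real, real_inner_comm]
  have e' : ⟪x, y - x⟫ = ⟪x, y⟫ - ‖x‖ ^ 2 := by
    rw [inner_sub_right, real_inner_self_eq_norm_sq]
  rw [e'] at h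
  rw [e]
  linarith

/-- The descent lemma. -/
lemma le_add_inner_add_sq_of_lipschitz {K : ℝ} (hgrad : ∀ x, HasGradientAt f (f' x) x)
    (hsmooth : ∀ x y, ‖f' x - f' y‖ ≤ K * ‖x - y‖) (x y : E) :
    f y ≤ f x + ⟪f' x, y - x⟫ + K / 2 * ‖y - x‖ ^ 2 := by
  have hd (t : ℝ) := hasDerivAt_comp_add_smul hgrad x (y - x) t
  have hB (t : ℝ) : HasDerivAt
      (fun s : ℝ => f x + s * ⟪f' x, y - x⟫ + s ^ 2 * (K / 2 * ‖y - x‖ ^ 2))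
      (⟪f' x, y - x⟫ + 2 * t * (K / 2 * ‖y - x‖ ^ 2)) t := by
    have h₁ := ((hasDerivAt_id t).mul_const ⟪f' x, y - x⟫).const_add (f x)
    have h₂ := (hasDerivAt_pow 2 t).mul_const (K / 2 * ‖y - x‖ ^ 2)
    simpa using h₁.fun_add h₂
  have key := image_le_of_deriv_right_le_deriv_boundary (a := 0) (b := 1)
    (fun t _ => (hd t).continuousAt.continuousWithinAt)
    (fun t _ => (hd t).hasDerivWithinAt) (by simp)
    (fun t _ => (hB t).continuousAt.continuousWithinAt)
    (fun t _ => (hB t).hasDerivWithinAt) (fun t ht => ?_) (Set.right_mem_Icc.2 zero_le_one)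
  · simpa using key
  · have h₁ : ⟪f' (x + t • (y - x)) - f' x, y - x⟫ ≤ K * (t * ‖y - x‖) * ‖y - x‖ := by
      refine (real_inner_le_norm _ _).trans ?_
      gcongr
      refine (hsmooth _ _).trans_eq ?_
      rw [add_sub_cancel_left, norm_smul, Real.norm_of_nonneg ht.1]
    rw [inner_sub_left] at h₁
    nlinarith

/-- The Baillon–Haddad inequality: the gradient of a smooth convex function is cocoercive. -/
lemma norm_sq_le_mul_inner_of_convex {K : ℝ} (hK : 0 < K)
    (hgrad : ∀ x, HasGradientAt f (f' x) x)
    (hsmooth : ∀ x y, ‖f' x - f' y‖ ≤ K * ‖x - y‖)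
    (hconv : ∀ x y, f x + ⟪f' x, y - x⟫ ≤ f y) (x y : E) :
    ‖f' x - f' y‖ ^ 2 ≤ K * ⟪f' x - f' y, x - y⟫ := by
  have half (x y : E) :
      f x + ⟪f' x, y - x⟫ + 1 / (2 * K) * ‖f' x - f' y‖ ^ 2 ≤ f y := by
    set g := f' x - f' y with hg
    have h₁ := hconv x (y + K⁻¹ • g)
    have h₂ := le_add_inner_add_sq_of_lipschitz hgrad hsmooth y (y + K⁻¹ • g)
    rw [add_sub_cancel_left, norm_smul, inner_smul_right, Real.norm_of_nonneg (by positivity)]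
      at h₂
    rw [add_sub_right_comm, inner_add_right, inner_smul_right] at h₁
    have h₃ : ⟪f' x, g⟫ - ⟪f' y, g⟫ = ‖g‖ ^ 2 := by
      rw [← inner_sub_left, ← hg, real_inner_self_eq_norm_sq]
    have h₄ : K / 2 * (K⁻¹ * ‖g‖) ^ 2 = 1 / (2 * K) * ‖g‖ ^ 2 := by
      field_simp
    have h₅ : K⁻¹ * ⟪f' x, g⟫ - K⁻¹ * ⟪f' y, g⟫ = 2 * (1 / (2 * K) * ‖g‖ ^ 2) := by
      rw [← mul_sub, h₃]
      field_simp
    linarith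
  have h₁ := half x y
  have h₂ := half y x
  rw [norm_sub_rev (f' y)] at h₂
  have h₃ : ⟪f' x - f' y, x - y⟫ = -⟪f' x, y - x⟫ - ⟪f' y, x - y⟫ := by
    rw [inner_sub_left, ← neg_sub x y, inner_neg_right, neg_neg]
  have h₄ : K⁻¹ * ‖f' x - f' y‖ ^ 2 ≤ ⟪f' x - f' y, x - y⟫ := by
    have : K⁻¹ * ‖f' x - f' y‖ ^ 2 = 2 * (1 / (2 * K) * ‖f' x - f' y‖ ^ 2) := by field_simp
    linarith
  rwa [inv_mul_le_iff₀ hK] at h₄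

/-- A gradient step with step size at most `1 / K` contracts distances. -/
lemma norm_gradient_step_sq_le {K μ γ : ℝ} (hK : 0 < K) (hμ : 0 ≤ μ) (hγ : 0 ≤ γ)
    (hγK : γ ≤ 1 / K) (hgrad : ∀ x, HasGradientAt f (f' x) x)
    (hsmooth : ∀ x y, ‖f' x - f' y‖ ≤ K * ‖x - y‖)
    (hsc : ConvexOn ℝ Set.univ fun x => f x - μ / 2 * ‖x‖ ^ 2) (x y : E) :
    ‖(x - y) - γ • (f' x - f' y)‖ ^ 2 ≤ (1 - γ * μ) * ‖x - y‖ ^ 2 := by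
  have lower := add_inner_add_sq_le_of_stronglyConvex hgrad hsc
  have hcoco := norm_sq_le_mul_inner_of_convex hK hgrad hsmooth
    (fun x y => by nlinarith [lower x y, sq_nonneg ‖y - x‖]) x y
  have hmono : μ * ‖x - y‖ ^ 2 ≤ ⟪f' x - f' y, x - y⟫ := by
    have h₁ := lower x y
    have h₂ := lower y x
    have h₃ : ⟪f' x - f' y, x - y⟫ = -⟪f' x, y - x⟫ - ⟪f' y, x - y⟫ := by
      rw [inner_sub_left, ← neg_sub x y, inner_neg_right, neg_neg]
    rw [norm_sub_rev y x] at h₁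
    linarith
  have hγK' : γ * K ≤ 1 := by rwa [le_div_iff₀ hK] at hγK
  have hinner : 0 ≤ ⟪f' x - f' y, x - y⟫ := le_trans (by positivity) hmono
  have hsq : γ * (γ * ‖f' x - f' y‖ ^ 2) ≤ γ * ⟪f' x - f' y, x - y⟫ := by
    gcongr
    nlinarith
  rw [norm_sub_sq_real, inner_smul_right, norm_smul, Real.norm_of_nonneg hγ, real_inner_comm]
  nlinarith

end Gradient

section Conjugate

variable {m : ℕ} {ψ : Euc m → EReal}

lemma fenchelConj_ne_bot (hψ : ProperClosedConvex ψ) (y : Euc m) : fenchelConj ψ y ≠ ⊥ := by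
  obtain ⟨x, hx⟩ := hψ.1
  refine ne_bot_of_le_ne_bot ?_
    (le_iSup (fun x : Euc m => ((⟪x, y⟫ : ℝ) : EReal) - ψ x) x)
  lift ψ x to ℝ using ⟨hx, hψ.2.1 x⟩ with r
  exact EReal.coe_ne_bot (⟪x, y⟫ - r)

lemma fenchelConj_le_coe_iff (hbot : ∀ x, ψ x ≠ ⊥) (y : Euc m) (r : ℝ) :
    fenchelConj ψ y ≤ r ↔ ∀ (x : Euc m) (s : ℝ), ψ x = s → ⟪x, y⟫ - s ≤ r := by
  rw [fenchelConj, iSup_le_iff]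
  refine forall_congr' fun x => ⟨fun h s hs => ?_, fun h => ?_⟩
  · rw [hs] at h
    exact_mod_cast h
  · induction hx : ψ x with
    | bot => exact absurd hx (hbot x)
    | top => simp
    | coe s => exact_mod_cast h s hx

/-- The conjugate of a proper closed convex function is finite somewhere. -/
lemma exists_fenchelConj_ne_top (hψ : ProperClosedConvex ψ) : ∃ y, fenchelConj ψ y ≠ ⊤ := by
  obtain ⟨⟨x₀, hx₀⟩, hbot, hlsc, hconv⟩ := hψ
  obtain ⟨r₀, hr₀⟩ : ∃ r : ℝ, ψ x₀ = r := ⟨_, (EReal.coe_toReal hx₀ (hbot x₀)).symm⟩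
  let S : Set (Euc m × ℝ) := {q | ψ q.1 ≤ (q.2 : EReal)}
  have hS : IsClosed S := hlsc.isClosed_epigraph.preimage
    (continuous_fst.prodMk (continuous_coe_real_ereal.comp continuous_snd))
  have hSc : Convex ℝ S := by
    rintro ⟨x, r⟩ hx ⟨y, s⟩ hy a b ha hb hab
    refine (hconv x y a b ha hb hab).trans ?_
    have h₁ : (a : EReal) * ψ x ≤ a * r := mul_le_mul_of_nonneg_left hx (by exact_mod_cast ha)
    have h₂ : (b : EReal) * ψ y ≤ b * s := mul_le_mul_of_nonneg_left hy (by exact_mod_cast hb)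
    refine (add_le_add h₁ h₂).trans_eq ?_
    simp
  have hx : ((x₀, r₀ - 1) : Euc m × ℝ) ∉ S := by
    simp only [S, Set.mem_ofPred_eq, hr₀, EReal.coe_le_coe_iff]
    linarith
  obtain ⟨φ, u, hu, hφ⟩ := geometric_hahn_banach_point_closed hSc hS hx
  set c : ℝ := φ (0, 1) with hc
  set a : Euc m :=
    (InnerProductSpace.toDual ℝ (Euc m)).symm (φ.comp (ContinuousLinearMap.inl ℝ (Euc m) ℝ))
    with ha
  have hdecomp (x : Euc m) (r : ℝ) : φ (x, r) = ⟪a, x⟫ + r * c := by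
    have e₁ : ⟪a, x⟫ = φ (x, 0) := by
      rw [ha, InnerProductSpace.toDual_symm_apply]
      rfl
    have e₂ : r * c = φ (0, r) := by
      rw [hc, ← smul_eq_mul, ← map_smul]
      simp
    rw [e₁, e₂, ← map_add]
    simp
  have hc0 : 0 < c := by
    have h := hφ (x₀, r₀) (by simp [S, hr₀])
    rw [hdecomp] at h hu
    nlinarith
  refine ⟨-c⁻¹ • a, ne_top_of_le_ne_top (EReal.coe_ne_top (-c⁻¹ * u))
    ((fenchelConj_le_coe_iff hbot _ _).2 fun x s hs => ?_)⟩
  have h := hφ (x, s) (by simp [S, hs])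
  rw [hdecomp] at h
  rw [inner_smul_right, real_inner_comm]
  have : c⁻¹ * u ≤ c⁻¹ * (⟪a, x⟫ + s * c) := by gcongr
  have e : c⁻¹ * (⟪a, x⟫ + s * c) = c⁻¹ * ⟪a, x⟫ + s := by field_simp
  linarith

lemma ERealSubgrad.ne_top {φ : Euc m → EReal} {y g : Euc m} (h : ERealSubgrad φ y g)
    (hφ : ∃ z, φ z ≠ ⊤) : φ y ≠ ⊤ := by
  obtain ⟨z, hz⟩ := hφ
  intro hy
  have := h z
  rw [hy, EReal.top_add_coe, top_le_iff] at this
  exact hz this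

lemma ERealSubgrad.inner_sub_nonneg {φ : Euc m → EReal} {y₁ g₁ y₂ g₂ : Euc m}
    (hbot : ∀ z, φ z ≠ ⊥) (htop : ∃ z, φ z ≠ ⊤)
    (h₁ : ERealSubgrad φ y₁ g₁) (h₂ : ERealSubgrad φ y₂ g₂) :
    0 ≤ ⟪g₁ - g₂, y₁ - y₂⟫ := by
  have k₁ := h₁ y₂
  have k₂ := h₂ y₁
  lift φ y₁ to ℝ using ⟨h₁.ne_top htop, hbot _⟩ with a
  lift φ y₂ to ℝ using ⟨h₂.ne_top htop, hbot _⟩ with b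
  norm_cast at k₁ k₂
  rw [← neg_sub y₁ y₂, inner_neg_right] at k₁
  rw [inner_sub_left]
  linarith

lemma fenchelConj_segment_le (hbot : ∀ x, ψ x ≠ ⊥) {q z : Euc m} {a b t : ℝ}
    (ha : fenchelConj ψ q = a) (hb : fenchelConj ψ z = b) (ht : 0 ≤ t) (ht1 : t ≤ 1) :
    fenchelConj ψ (q + t • (z - q)) ≤ ((a + t * (b - a) : ℝ) : EReal) := by
  rw [fenchelConj_le_coe_iff hbot]
  intro x s hs
  have h₁ := (fenchelConj_le_coe_iff hbot q a).1 ha.le x s hs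
  have h₂ := (fenchelConj_le_coe_iff hbot z b).1 hb.le x s hs
  rw [inner_add_right, inner_smul_right, inner_sub_right]
  nlinarith

/-- The optimality condition of a proximal point of a conjugate function. -/
lemma IsProxPt.erealSubgrad (hψ : ProperClosedConvex ψ) {τ : ℝ} (hτ : 0 < τ) {u q : Euc m}
    (hq : IsProxPt (fenchelConj ψ) τ u q) :
    ERealSubgrad (fenchelConj ψ) q (τ⁻¹ • (u - q)) := by
  have hbot := fenchelConj_ne_bot hψ
  have hqtop : fenchelConj ψ q ≠ ⊤ := by
    obtain ⟨y, hy⟩ := exists_fenchelConj_ne_top hψ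
    intro h
    have := hq y
    lift fenchelConj ψ y to ℝ using ⟨hy, hbot y⟩ with b
    rw [h, EReal.coe_mul_top_of_pos hτ, EReal.coe_add_top, top_le_iff] at this
    exact EReal.coe_ne_top _ (by exact_mod_cast this)
  obtain ⟨a, ha⟩ : ∃ r : ℝ, fenchelConj ψ q = r := ⟨_, (EReal.coe_toReal hqtop (hbot q)).symm⟩
  intro z
  by_cases hz : fenchelConj ψ z = ⊤
  · rw [hz]
    exact le_top
  obtain ⟨b, hb⟩ : ∃ r : ℝ, fenchelConj ψ z = r := ⟨_, (EReal.coe_toReal hz (hbot z)).symm⟩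
  rw [ha, hb]
  norm_cast
  rw [inner_smul_left, RCLike.conj_to_real]
  set w := z - q with hw
  have key (t : ℝ) (ht : 0 < t) (ht1 : t ≤ 1) :
      ⟪u - q, w⟫ ≤ τ * (b - a) + t * (1 / 2 * ‖w‖ ^ 2) := by
    have hseg := fenchelConj_segment_le hψ.2.1 ha hb ht.le ht1
    have h := (hq (q + t • w)).trans
      (add_le_add le_rfl (mul_le_mul_of_nonneg_left hseg (by exact_mod_cast hτ.le)))
    rw [ha] at h
    norm_cast at h
    have e : q + t • w - u = t • w - (u - q) := by abel
    rw [e, norm_sub_sq_real (t • w), norm_smul, Real.norm_of_nonneg ht.le, norm_sub_rev q u,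
      inner_smul_left, RCLike.conj_to_real, real_inner_comm] at h
    have h' : t * ⟪u - q, w⟫ ≤ t * (τ * (b - a) + t * (1 / 2 * ‖w‖ ^ 2)) := by linarith
    exact le_of_mul_le_mul_left h' ht
  have hlim : ⟪u - q, w⟫ ≤ τ * (b - a) := by
    refine le_of_forall_pos_le_add fun ε hε => ?_
    have hpos : 0 < 1 / 2 * ‖w‖ ^ 2 + 1 := by positivity
    have h := key (min 1 (ε / (1 / 2 * ‖w‖ ^ 2 + 1))) (lt_min one_pos (by positivity))
      (min_le_left _ _)
    have h₂ : min 1 (ε / (1 / 2 * ‖w‖ ^ 2 + 1)) * (1 / 2 * ‖w‖ ^ 2) ≤ ε := by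
      calc _ ≤ ε / (1 / 2 * ‖w‖ ^ 2 + 1) * (1 / 2 * ‖w‖ ^ 2 + 1) := by
            gcongr
            · exact min_le_right _ _
            · linarith
        _ = ε := div_mul_cancel₀ _ hpos.ne'
    linarith
  have : τ⁻¹ * ⟪u - q, w⟫ ≤ τ⁻¹ * (τ * (b - a)) := by gcongr
  rw [inv_mul_cancel_left₀ hτ.ne'] at this
  linarith

end Conjugate

section Operator

variable {m d : ℕ} (L : Matrix (Fin m) (Fin d) ℝ)

lemma inner_toEuclideanLin_transpose (x : Euc d) (y : Euc m) :
    ⟪Matrix.toEuclideanLin Lᵀ y, x⟫ = ⟪y, Matrix.toEuclideanLin L x⟫ := by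
  have h := Matrix.toEuclideanLin_conjTranspose_eq_adjoint L
  rw [Matrix.conjTranspose_eq_transpose_of_trivial] at h
  rw [h, LinearMap.adjoint_inner_left]

lemma toEuclideanLin_mul_transpose_apply (y : Euc m) :
    Matrix.toEuclideanLin (L * Lᵀ) y =
      Matrix.toEuclideanLin L (Matrix.toEuclideanLin Lᵀ y) :=
  LinearMap.congr_fun (Matrix.toLpLin_mul 2 2 2 L Lᵀ) y

lemma inner_toEuclideanLin_mul_transpose (y z : Euc m) :
    ⟪y, Matrix.toEuclideanLin (L * Lᵀ) z⟫ =
      ⟪Matrix.toEuclideanLin Lᵀ y, Matrix.toEuclideanLin Lᵀ z⟫ := by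
  rw [toEuclideanLin_mul_transpose_apply, inner_toEuclideanLin_transpose]

lemma norm_toEuclideanLin_transpose_sq_le (y : Euc m) :
    ‖Matrix.toEuclideanLin Lᵀ y‖ ^ 2 ≤
      ‖LinearMap.toContinuousLinearMap
        (Matrix.toEuclideanLin (L * Lᵀ) : Euc m →ₗ[ℝ] Euc m)‖ * ‖y‖ ^ 2 := by
  rw [← real_inner_self_eq_norm_sq, ← inner_toEuclideanLin_mul_transpose]
  refine (real_inner_le_norm _ _).trans ?_
  have := (LinearMap.toContinuousLinearMap
    (Matrix.toEuclideanLin (L * Lᵀ) : Euc m →ₗ[ℝ] Euc m)).le_opNorm y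
  rw [LinearMap.coe_toContinuousLinearMap'] at this
  nlinarith [norm_nonneg y]

lemma toEuclideanLin_transpose_eq_zero_of_mem_orthogonal {k : Euc m}
    (hk : k ∈ (LinearMap.range (Matrix.toEuclideanLin L))ᗮ) :
    Matrix.toEuclideanLin Lᵀ k = 0 := by
  rw [← inner_self_eq_zero (𝕜 := ℝ), inner_toEuclideanLin_transpose]
  exact Submodule.inner_left_of_mem_orthogonal (LinearMap.mem_range_self _ _) hk

lemma lamMinPos_mul_norm_sq_le {v : Euc m}
    (hv : v ∈ LinearMap.range (Matrix.toEuclideanLin L)) :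
    lamMinPos L * ‖v‖ ^ 2 ≤ ‖Matrix.toEuclideanLin Lᵀ v‖ ^ 2 := by
  set M : Euc m →ₗ[ℝ] Euc m := Matrix.toEuclideanLin (L * Lᵀ) with hM
  have hsymm : M.IsSymmetric := fun y z => by
    rw [real_inner_comm, inner_toEuclideanLin_mul_transpose,
      inner_toEuclideanLin_mul_transpose, real_inner_comm]
  have hrank : Module.finrank ℝ (Euc m) = m := by simp
  let b := hsymm.eigenvectorBasis hrank
  let ev := hsymm.eigenvalues hrank
  have hb (i : Fin m) : M (b i) = ev i • b i := hsymm.apply_eigenvectorBasis hrank i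
  have hbne (i : Fin m) : b i ≠ 0 := b.orthonormal.ne_zero i
  have hnorm (i : Fin m) : ev i = ‖Matrix.toEuclideanLin Lᵀ (b i)‖ ^ 2 := by
    rw [← real_inner_self_eq_norm_sq, ← inner_toEuclideanLin_mul_transpose, ← hM, hb,
      inner_smul_right, real_inner_self_eq_norm_sq, b.orthonormal.1 i]
    simp
  have hterm (i : Fin m) : lamMinPos L * ⟪b i, v⟫ ^ 2 ≤ ev i * ⟪b i, v⟫ ^ 2 := by
    rcases (hnorm i ▸ sq_nonneg _ : 0 ≤ ev i).eq_or_lt with h0 | hpos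
    · have hz : Matrix.toEuclideanLin Lᵀ (b i) = 0 := by
        rw [← norm_eq_zero, ← sq_eq_zero_iff, ← hnorm, ← h0]
      obtain ⟨x, rfl⟩ := hv
      rw [← inner_toEuclideanLin_transpose, hz]
      simp
    · gcongr
      refine csInf_le ⟨0, fun r hr => hr.1.le⟩ ⟨hpos, ?_⟩
      exact Module.End.hasEigenvalue_of_hasEigenvector
        ⟨Module.End.mem_eigenspace_iff.2 (hb i), hbne i⟩
  have h₁ : ‖v‖ ^ 2 = ∑ i, ⟪b i, v⟫ ^ 2 := by
    simp [← b.sum_sq_norm_inner_right v]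
  have h₂ : ‖Matrix.toEuclideanLin Lᵀ v‖ ^ 2 = ∑ i, ev i * ⟪b i, v⟫ ^ 2 := by
    rw [← real_inner_self_eq_norm_sq, ← inner_toEuclideanLin_mul_transpose, ← hM,
      ← b.sum_inner_mul_inner]
    refine Finset.sum_congr rfl fun i _ => ?_
    rw [← hsymm, hb, inner_smul_left, RCLike.conj_to_real, real_inner_comm]
    ring
  rw [h₁, h₂, Finset.mul_sum]
  exact Finset.sum_le_sum fun i _ => hterm i

end Operator

section Dual

variable {m : ℕ} {ψ : Euc m → EReal}

/-- If all subgradients of `ψ*` lie in a subspace `R`, then a dual solution can be moved to its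
orthogonal projection onto `R`. -/
lemma ERealSubgrad.starProjection (hψ : ProperClosedConvex ψ) {R : Submodule ℝ (Euc m)}
    (hR : ∀ y g, ERealSubgrad (fenchelConj ψ) y g → g ∈ R) {τ : ℝ} (hτ : 0 < τ)
    {proxStar : Euc m → Euc m} (hprox : ∀ u, IsProxPt (fenchelConj ψ) τ u (proxStar u))
    {y g : Euc m} (h : ERealSubgrad (fenchelConj ψ) y g) :
    ERealSubgrad (fenchelConj ψ) (R.starProjection y) g := by
  set z := R.starProjection y with hz
  set q := proxStar (z + τ • g) with hq
  have hsub := (hprox (z + τ • g)).erealSubgrad hψ hτ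
  rw [← hq] at hsub
  have hzq : z - q ∈ R := by
    have h₁ := R.sub_mem (R.smul_mem τ (hR _ _ hsub)) (R.smul_mem τ (hR _ _ h))
    rw [smul_inv_smul₀ hτ.ne'] at h₁
    convert h₁ using 1
    abel
  have hmono := hsub.inner_sub_nonneg (fenchelConj_ne_bot hψ) (exists_fenchelConj_ne_top hψ) h
  have e₁ : τ⁻¹ • (z + τ • g - q) - g = τ⁻¹ • (z - q) := by
    rw [add_sub_right_comm, smul_add, inv_smul_smul₀ hτ.ne', add_sub_cancel_right]
  have e₂ : q - y = -(z - q) - (y - z) := by abel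
  have e₃ : ⟪z - q, y - z⟫ = 0 :=
    Submodule.inner_right_of_mem_orthogonal hzq (R.sub_starProjection_mem_orthogonal y)
  rw [e₁, e₂, inner_smul_left, RCLike.conj_to_real, inner_sub_right, e₃, inner_neg_right,
    real_inner_self_eq_norm_sq, sub_zero] at hmono
  have hzero : z = q := by
    rw [← sub_eq_zero, ← norm_eq_zero, ← sq_eq_zero_iff]
    have : 0 ≤ -‖z - q‖ ^ 2 := nonneg_of_mul_nonneg_right hmono (by positivity)
    exact le_antisymm (by linarith) (sq_nonneg _)
  rw [← hzero] at hsub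
  simpa [inv_smul_smul₀ hτ.ne'] using hsub

end Dual

section Trajectory

variable {m d : ℕ}

lemma splitSkipTraj_congr (f' : Euc d → Euc d) (L : Matrix (Fin m) (Fin d) ℝ)
    (proxStar : Euc m → Euc m) (γ τ p : ℝ) (x0 : Euc d) {θ θ' : ℕ → Bool} {n : ℕ}
    (h : ∀ t < n, θ t = θ' t) :
    splitSkipTraj f' L proxStar γ τ p x0 θ n = splitSkipTraj f' L proxStar γ τ p x0 θ' n := by
  induction n with
  | zero => rfl
  | succ n ih =>
    rw [splitSkipTraj, splitSkipTraj, ih fun t ht => h t (by lia), h n n.lt_succ_self]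

/-- A one-step contraction in expectation iterates to a linear rate over `T` coin flips. -/
lemma sum_coin_mul_splitSkipTraj_le (f' : Euc d → Euc d) (L : Matrix (Fin m) (Fin d) ℝ)
    (proxStar : Euc m → Euc m) (γ τ p : ℝ) (hp : 0 ≤ p) (hp1 : p ≤ 1) (x0 : Euc d)
    (Inv : Euc d × Euc m → Prop) (Φ : Euc d × Euc m → ℝ) {ρ : ℝ} (hρ : 0 ≤ ρ)
    (hInv0 : Inv (x0, 0))
    (hInv : ∀ s θ, Inv s → Inv (splitSkipStep f' L proxStar γ τ p θ s))
    (hstep : ∀ s, Inv s → p * Φ (splitSkipStep f' L proxStar γ τ p true s) +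
      (1 - p) * Φ (splitSkipStep f' L proxStar γ τ p false s) ≤ ρ * Φ s) (T : ℕ) :
    (∑ σ : Fin T → Bool, (∏ i : Fin T, if σ i then p else 1 - p) *
      Φ (splitSkipTraj f' L proxStar γ τ p x0
        (fun t => if h : t < T then σ ⟨t, h⟩ else false) T)) ≤ ρ ^ T * Φ (x0, 0) := by
  have hTraj (θ : ℕ → Bool) (n : ℕ) : Inv (splitSkipTraj f' L proxStar γ τ p x0 θ n) := by
    induction n with
    | zero => exact hInv0
    | succ n ih => exact hInv _ _ ih
  induction T with
  | zero => simp [splitSkipTraj]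
  | succ T ih =>
    rw [← (Fin.snocEquiv fun _ : Fin (T + 1) => Bool).sum_comp, Fintype.sum_prod_type,
      Finset.sum_comm]
    have hinner (σ : Fin T → Bool) :
        (∑ b : Bool, (∏ i : Fin (T + 1),
            if (Fin.snocEquiv fun _ : Fin (T + 1) => Bool) (b, σ) i then p else 1 - p) *
          Φ (splitSkipTraj f' L proxStar γ τ p x0
            (fun t => if h : t < T + 1 then
              (Fin.snocEquiv fun _ : Fin (T + 1) => Bool) (b, σ) ⟨t, h⟩ else false) (T + 1))) ≤
        ρ * ((∏ i : Fin T, if σ i then p else 1 - p) *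
          Φ (splitSkipTraj f' L proxStar γ τ p x0
            (fun t => if h : t < T then σ ⟨t, h⟩ else false) T)) := by
      set s := splitSkipTraj f' L proxStar γ τ p x0
        (fun t => if h : t < T then σ ⟨t, h⟩ else false) T with hs
      have htraj (b : Bool) : splitSkipTraj f' L proxStar γ τ p x0
          (fun t => if h : t < T + 1 then
            (Fin.snocEquiv fun _ : Fin (T + 1) => Bool) (b, σ) ⟨t, h⟩ else false) (T + 1) =
          splitSkipStep f' L proxStar γ τ p b s := by
        rw [splitSkipTraj, hs]
        congr 1
        · simp [Fin.snoc]
        · refine splitSkipTraj_congr _ _ _ _ _ _ _ fun t ht => ?_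
          simp [Fin.snoc, ht, ht.trans T.lt_succ_self]
      have hweight : 0 ≤ ∏ i : Fin T, if σ i then p else 1 - p :=
        Finset.prod_nonneg fun i _ => by split_ifs <;> linarith
      rw [Fintype.sum_bool, htraj, htraj]
      simp only [Fin.snocEquiv_apply, Fin.prod_univ_castSucc, Fin.snoc_castSucc,
        Fin.snoc_last, if_true, Bool.false_eq_true, if_false]
      have := mul_le_mul_of_nonneg_left (hstep s (hTraj _ _)) hweight
      linarith
    calc _ ≤ _ := Finset.sum_le_sum fun σ _ => hinner σ
      _ ≤ ρ * (ρ ^ T * Φ (x0, 0)) := by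
        rw [← Finset.mul_sum]
        gcongr
      _ = ρ ^ (T + 1) * Φ (x0, 0) := by ring

end Trajectory

section Contraction

variable {E F : Type*} [NormedAddCommGroup E] [InnerProductSpace ℝ E]
  [NormedAddCommGroup F] [InnerProductSpace ℝ F]

/-- Energy estimate for a communication step with primal error `e`, dual error `v` and dual
increment `δ`. -/
lemma communication_energy_le (B : F →ₗ[ℝ] E) {γ τ p N : ℝ} (hγ : 0 < γ) (hτ : 0 < τ)
    (hp : 0 < p) (hN : γ * τ * N ≤ p) (hB : ∀ y, ‖B y‖ ^ 2 ≤ N * ‖y‖ ^ 2) (e : E) (v δ : F)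
    (hmono : τ⁻¹ * ⟪δ, v + δ⟫ ≤ ⟪e, B (v + δ)⟫) :
    ‖e - (γ / p) • B δ‖ ^ 2 + γ / (p * τ) * ‖v + δ‖ ^ 2 ≤
      ‖e‖ ^ 2 + γ / (p * τ) * ‖v‖ ^ 2 + 2 * (γ / p) * ⟪e, B v⟫ := by
  have hquad : (γ / p) ^ 2 * ‖B δ‖ ^ 2 ≤ γ / (p * τ) * ‖δ‖ ^ 2 := by
    calc (γ / p) ^ 2 * ‖B δ‖ ^ 2 ≤ (γ / p) ^ 2 * (N * ‖δ‖ ^ 2) := by gcongr; exact hB δ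
      _ = γ / (p ^ 2 * τ) * (γ * τ * N) * ‖δ‖ ^ 2 := by field_simp
      _ ≤ γ / (p ^ 2 * τ) * p * ‖δ‖ ^ 2 := by gcongr
      _ = γ / (p * τ) * ‖δ‖ ^ 2 := by field_simp
  have hcross := mul_le_mul_of_nonneg_left hmono (by positivity : 0 ≤ 2 * (γ / p))
  have hc : γ / (p * τ) = γ / p * τ⁻¹ := by field_simp
  rw [map_add, inner_add_right, inner_add_right, real_inner_self_eq_norm_sq,
    real_inner_comm v δ] at hcross
  rw [hc] at hquad ⊢
  rw [norm_sub_sq_real, norm_add_sq_real, inner_smul_right, norm_smul,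
    Real.norm_of_nonneg (by positivity), mul_pow]
  linarith

/-- Expected energy decrease over one step, where `a` is the primal error after the gradient
step and `v` the dual error. -/
lemma expected_energy_le (B : F →ₗ[ℝ] E) {γ τ p N lam μ r : ℝ} (hγ : 0 < γ) (hτ : 0 < τ)
    (hp : 0 < p) (hN : γ * τ * N ≤ p) (hB : ∀ y, ‖B y‖ ^ 2 ≤ N * ‖y‖ ^ 2) (a : E) (v δ : F)
    (hr : 0 ≤ r) (ha : ‖a‖ ^ 2 ≤ (1 - γ * μ) * r) (hv : lam * ‖v‖ ^ 2 ≤ ‖B v‖ ^ 2)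
    (hmono : τ⁻¹ * ⟪δ, v + δ⟫ ≤ ⟪a - γ • B v, B (v + δ)⟫) :
    p * (‖a - γ • B v - (γ / p) • B δ‖ ^ 2 + γ / (p * τ) * ‖v + δ‖ ^ 2) +
      (1 - p) * (‖a - γ • B v‖ ^ 2 + γ / (p * τ) * ‖v‖ ^ 2) ≤
      (1 - min (γ * μ) (p * γ * τ * lam)) * (r + γ / (p * τ) * ‖v‖ ^ 2) := by
  have hcomm := mul_le_mul_of_nonneg_left
    (communication_energy_le B hγ hτ hp hN hB _ v δ hmono) hp.le
  have hcancel : p * (2 * (γ / p) * ⟪a - γ • B v, B v⟫) = 2 * γ * ⟪a - γ • B v, B v⟫ := by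
    field_simp
  have hprimal : ‖a - γ • B v‖ ^ 2 + 2 * γ * ⟪a - γ • B v, B v⟫ =
      ‖a‖ ^ 2 - γ ^ 2 * ‖B v‖ ^ 2 := by
    rw [norm_sub_sq_real, inner_sub_left, inner_smul_left, inner_smul_right, norm_smul,
      Real.norm_of_nonneg hγ.le, real_inner_self_eq_norm_sq, RCLike.conj_to_real]
    ring
  have hdual : p * γ * τ * lam * (γ / (p * τ) * ‖v‖ ^ 2) ≤ γ ^ 2 * ‖B v‖ ^ 2 := by
    calc p * γ * τ * lam * (γ / (p * τ) * ‖v‖ ^ 2) = γ ^ 2 * (lam * ‖v‖ ^ 2) := by field_simp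
      _ ≤ γ ^ 2 * ‖B v‖ ^ 2 := by gcongr
  have h₁ : min (γ * μ) (p * γ * τ * lam) * r ≤ γ * μ * r := by
    gcongr
    exact min_le_left _ _
  have h₂ : min (γ * μ) (p * γ * τ * lam) * (γ / (p * τ) * ‖v‖ ^ 2) ≤
      p * γ * τ * lam * (γ / (p * τ) * ‖v‖ ^ 2) := by
    gcongr
    exact min_le_right _ _
  linarith

end Contraction

/-- Decentralized SplitSkip convergence (Theorem 4 in the paper):
`E[‖x_T - x⋆‖²] ≤ (1-ζ)^T Φ₀` with `ζ = min{γμ, pγτ λ_min⁺(L Lᵀ)}`. -/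
theorem splitskip_convergence {m d' : ℕ}
    (f : Euc d' → ℝ) (f' : Euc d' → Euc d') (ψ : Euc m → EReal)
    (Lm : Matrix (Fin m) (Fin d') ℝ)
    (Lf μ γ τ p : ℝ) (hLf : 0 < Lf) (hμ : 0 < μ)
    (hgrad : ∀ x, HasGradientAt f (f' x) x)
    (hsmooth : ∀ x y, ‖f' x - f' y‖ ≤ Lf * ‖x - y‖)
    (hsc : ConvexOn ℝ Set.univ fun x => f x - μ / 2 * ‖x‖ ^ 2)
    (hψ : ProperClosedConvex ψ)
    (hrange : ∀ y g : Euc m, ERealSubgrad (fenchelConj ψ) y g →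
      g ∈ LinearMap.range (Matrix.toEuclideanLin Lm))
    (hp : 0 < p) (hp1 : p ≤ 1) (hγ : 0 < γ) (hγL : γ ≤ 1 / Lf) (hτ : 0 < τ)
    (hγτ : γ * τ ≤ p / ‖LinearMap.toContinuousLinearMap
        (Matrix.toEuclideanLin (Lm * Lmᵀ) : Euc m →ₗ[ℝ] Euc m)‖)
    -- the prox operator of the Fenchel conjugate `ψ*`
    (proxStar : Euc m → Euc m)
    (hproxStar : ∀ u, IsProxPt (fenchelConj ψ) τ u (proxStar u))
    -- primal-dual optimality: `∇f(x⋆) + Lᵀ y⋆ = 0` and `L x⋆ ∈ ∂ψ*(y⋆)`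
    (xstar : Euc d') (ystar : Euc m)
    (hopt1 : f' xstar + Matrix.toEuclideanLin Lmᵀ ystar = 0)
    (hopt2 : ERealSubgrad (fenchelConj ψ) ystar (Matrix.toEuclideanLin Lm xstar))
    (x0 : Euc d') (T : ℕ) :
    (∑ σ : Fin T → Bool,
        (∏ i : Fin T, if σ i then p else 1 - p) *
          ‖(splitSkipTraj f' Lm proxStar γ τ p x0
              (fun t => if h : t < T then σ ⟨t, h⟩ else false) T).1 - xstar‖ ^ 2)
      ≤ (1 - min (γ * μ) (p * γ * τ * lamMinPos Lm)) ^ T *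
          (‖x0 - xstar‖ ^ 2 + γ / (p * τ) * ‖(0 : Euc m) - ystar‖ ^ 2) := by
  set B : Euc m →ₗ[ℝ] Euc d' := Matrix.toEuclideanLin Lmᵀ with hB
  set A : Euc d' →ₗ[ℝ] Euc m := Matrix.toEuclideanLin Lm with hA
  set N : ℝ := ‖LinearMap.toContinuousLinearMap
    (Matrix.toEuclideanLin (Lm * Lmᵀ) : Euc m →ₗ[ℝ] Euc m)‖ with hN
  have hadj (x : Euc d') (y : Euc m) : ⟪B y, x⟫ = ⟪y, A x⟫ := inner_toEuclideanLin_transpose Lm x y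
  have hBnorm (y : Euc m) : ‖B y‖ ^ 2 ≤ N * ‖y‖ ^ 2 := norm_toEuclideanLin_transpose_sq_le Lm y
  have hNpos : 0 < N := by
    refine (norm_nonneg _).lt_of_ne fun h => ?_
    rw [hN, ← h, div_zero] at hγτ
    exact (mul_pos hγ hτ).not_ge hγτ
  have hγτN : γ * τ * N ≤ p := (le_div_iff₀ hNpos).1 hγτ
  have hcontr := norm_gradient_step_sq_le hLf hμ.le hγ.le hγL hgrad hsmooth hsc
  have hγμ : γ * μ ≤ 1 := by
    obtain ⟨x, hx⟩ : ∃ x : Euc d', x ≠ 0 := by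
      by_contra! hzero
      refine hNpos.ne' ((norm_eq_zero (E := Euc m →L[ℝ] Euc m)).2
        (ContinuousLinearMap.ext fun y => ?_))
      rw [LinearMap.coe_toContinuousLinearMap', toEuclideanLin_mul_transpose_apply,
        hzero (Matrix.toEuclideanLin Lmᵀ y)]
      simp
    have h := (sq_nonneg _).trans (hcontr x 0)
    rw [sub_zero] at h
    have := nonneg_of_mul_nonneg_left h (by positivity)
    linarith
  set ρ : ℝ := 1 - min (γ * μ) (p * γ * τ * lamMinPos Lm) with hρ
  have hρ0 : 0 ≤ ρ := by
    rw [hρ]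
    linarith [min_le_left (γ * μ) (p * γ * τ * lamMinPos Lm)]
  set R : Submodule ℝ (Euc m) := LinearMap.range A with hR
  set z : Euc m := R.starProjection ystar with hz
  have hzR : z ∈ R := R.starProjection_apply_mem ystar
  have hBz : B z = B ystar := by
    have h := toEuclideanLin_transpose_eq_zero_of_mem_orthogonal Lm
      (R.sub_starProjection_mem_orthogonal ystar)
    rw [← hB, map_sub, sub_eq_zero] at h
    exact h.symm
  have hzsub : ERealSubgrad (fenchelConj ψ) z (A xstar) :=
    hopt2.starProjection hψ hrange hτ hproxStar
  have hgradstar : f' xstar = -B z := by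
    rw [hBz]
    exact eq_neg_of_add_eq_zero_left hopt1
  let Φ : Euc d' × Euc m → ℝ := fun s => ‖s.1 - xstar‖ ^ 2 + γ / (p * τ) * ‖s.2 - z‖ ^ 2
  have hInv (s : Euc d' × Euc m) (θ : Bool) (hs : s.2 ∈ R) :
      (splitSkipStep f' Lm proxStar γ τ p θ s).2 ∈ R := by
    cases θ with
    | false => exact hs
    | true =>
      set u := s.2 + τ • A (s.1 - γ • (f' s.1 + B s.2)) with hu
      have h := R.smul_mem τ (hrange _ _ ((hproxStar u).erealSubgrad hψ hτ))
      rw [smul_inv_smul₀ hτ.ne'] at h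
      have huR : u ∈ R := R.add_mem hs (R.smul_mem τ (LinearMap.mem_range_self A _))
      exact (R.sub_mem_iff_right huR).1 h
  have hstep (s : Euc d' × Euc m) (hs : s.2 ∈ R) :
      p * Φ (splitSkipStep f' Lm proxStar γ τ p true s) +
        (1 - p) * Φ (splitSkipStep f' Lm proxStar γ τ p false s) ≤ ρ * Φ s := by
    obtain ⟨x, y⟩ := s
    set xhat := x - γ • (f' x + B y) with hxhat
    set q := proxStar (y + τ • A xhat) with hq
    set a := (x - xstar) - γ • (f' x - f' xstar) with ha
    have hxa : xhat - xstar = a - γ • B (y - z) := by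
      rw [hxhat, ha, hgradstar, map_sub]
      module
    have hmono : τ⁻¹ * ⟪q - y, y - z + (q - y)⟫ ≤ ⟪a - γ • B (y - z), B (y - z + (q - y))⟫ := by
      have h := ((hproxStar (y + τ • A xhat)).erealSubgrad hψ hτ).inner_sub_nonneg
        (fenchelConj_ne_bot hψ) (exists_fenchelConj_ne_top hψ) hzsub
      rw [← hq] at h
      have e : τ⁻¹ • (y + τ • A xhat - q) - A xstar = A (xhat - xstar) - τ⁻¹ • (q - y) := by
        have : τ⁻¹ • (y + τ • A xhat - q) = A xhat - τ⁻¹ • (q - y) := by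
          rw [← inv_smul_smul₀ hτ.ne' (A xhat), ← smul_sub, smul_inv_smul₀ hτ.ne']
          congr 1
          abel
        rw [this, map_sub A xhat, sub_right_comm]
      rw [e, inner_sub_left, inner_smul_left, RCLike.conj_to_real] at h
      rw [show y - z + (q - y) = q - z by abel, ← hxa, real_inner_comm, real_inner_comm (B _),
        hadj, real_inner_comm (q - y), real_inner_comm (A _)]
      linarith
    have h := expected_energy_le B hγ hτ hp hγτN hBnorm a (y - z) (q - y)
      (sq_nonneg ‖x - xstar‖) (hcontr x xstar)
      (lamMinPos_mul_norm_sq_le Lm (R.sub_mem hs hzR)) hmono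
    have etrue : xhat - (γ / p) • B (q - y) - xstar = a - γ • B (y - z) - (γ / p) • B (q - y) := by
      rw [← hxa]
      abel
    rw [← etrue, ← hxa, show y - z + (q - y) = q - z by abel] at h
    exact h
  have hmain := sum_coin_mul_splitSkipTraj_le f' Lm proxStar γ τ p hp.le hp1 x0 (fun s => s.2 ∈ R)
    Φ hρ0 R.zero_mem hInv hstep T
  refine le_trans (Finset.sum_le_sum fun σ _ => ?_) (hmain.trans ?_)
  · refine mul_le_mul_of_nonneg_left ?_
      (Finset.prod_nonneg fun i _ => by split_ifs <;> linarith)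
    exact le_add_of_nonneg_right (by positivity)
  · simp only [Φ, zero_sub, norm_neg]
    gcongr
    exact R.norm_starProjection_apply_le ystar
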